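/- Let X := ({(x, y, z) ∈ ℝ³ : y² + z² ≤ x²} ∪ {(x, y, z) ∈ ℝ³ : x² + z² ≤ y²}) ∩ {(x, y, z) ∈ ℝ³ : |z| ≤ x² + y²}, regarded as a subset of ℝ² × ℝ with coordinates ((x, y), z). Then X is not superquadratic at the origin — indeed θ(X,0) = 2 — and yet 0 ∈ closure(M_X). (This shows that for n ≥ 3, non-superquadraticity of a definable germ does not prevent the medial axis from reaching the point.) -/

import Mathlib

open Filter Topology Metric
open scoped ENNReal

noncomputable section

/-- The set of nearest points of `X` to `a`. -/
def nearestPts {E : Type*} [NormedAddCommGroup E] (X : Set E) (a : E) : Set E :=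
  {x | x ∈ X ∧ dist a x = Metric.infDist a X}

/-- The medial axis of `X`: points with at least two nearest points in `X`. -/
def medialAxis {E : Type*} [NormedAddCommGroup E] (X : Set E) : Set E :=
  {a | ∃ x ∈ nearestPts X a, ∃ y ∈ nearestPts X a, x ≠ y}

/-- ℝ³ viewed as ℝ² × ℝ, with coordinates `((x, y), z)` and the Euclidean (ℓ²) norm. -/
abbrev Amb3 := WithLp 2 (EuclideanSpace ℝ (Fin 2) × ℝ)

/-- The horizontal component `(x, y)` of a point of `ℝ² × ℝ`. -/
def xy (p : Amb3) : EuclideanSpace ℝ (Fin 2) := (WithLp.equiv 2 _ p).1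

/-- The vertical coordinate `z` of a point of `ℝ² × ℝ`. -/
def zc (p : Amb3) : ℝ := (WithLp.equiv 2 _ p).2

/-- The general curvature `θ(X,0)` of `X ⊆ ℝ² × ℝ` at `0`, as a supremum in `[0,+∞]`
with `sup ∅ = 0`; the germ `(X,0)` is superquadratic when `θ(X,0) < 2`. -/
def genCurv (X : Set Amb3) : ℝ≥0∞ :=
  sSup (ENNReal.ofReal ''
    {θ : ℝ | 0 < θ ∧ ∃ C > (0 : ℝ), ∃ U ∈ 𝓝 (0 : Amb3),
      X ∩ U ⊆ {p : Amb3 | ‖zc p‖ ≤ C * ‖xy p‖ ^ θ}})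

/-- The counterexample set
`X = ({y² + z² ≤ x²} ∪ {x² + z² ≤ y²}) ∩ {|z| ≤ x² + y²}`, regarded in `ℝ² × ℝ`. -/
def Xset : Set Amb3 :=
  ({p : Amb3 | (xy p 1) ^ 2 + (zc p) ^ 2 ≤ (xy p 0) ^ 2} ∪
    {p : Amb3 | (xy p 0) ^ 2 + (zc p) ^ 2 ≤ (xy p 1) ^ 2}) ∩
    {p : Amb3 | |zc p| ≤ (xy p 0) ^ 2 + (xy p 1) ^ 2}

/-- The point of `ℝ² × ℝ` with coordinates `((a, b), c)`. -/
def mkPt (a b c : ℝ) : Amb3 := WithLp.toLp 2 (!₂[a, b], c)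

@[simp] lemma xy_mkPt_zero (a b c : ℝ) : xy (mkPt a b c) 0 = a := rfl

@[simp] lemma xy_mkPt_one (a b c : ℝ) : xy (mkPt a b c) 1 = b := rfl

@[simp] lemma zc_mkPt (a b c : ℝ) : zc (mkPt a b c) = c := rfl

lemma amb3_dist_eq (p q : Amb3) :
    dist p q = √((xy p 0 - xy q 0) ^ 2 + (xy p 1 - xy q 1) ^ 2 + (zc p - zc q) ^ 2) := by
  rw [WithLp.prod_dist_eq_of_L2, EuclideanSpace.dist_eq, Real.sq_sqrt (by positivity)]
  simp [Fin.sum_univ_two, Real.dist_eq, sq_abs, xy, zc]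

lemma continuous_xy : Continuous xy := by
  unfold xy
  exact (WithLp.prod_continuous_ofLp 2 _ _).fst

lemma continuous_zc : Continuous zc := by
  unfold zc
  exact (WithLp.prod_continuous_ofLp 2 _ _).snd

lemma continuous_xy_apply (i : Fin 2) : Continuous fun p => xy p i :=
  (EuclideanSpace.proj (𝕜 := ℝ) i).continuous.comp continuous_xy

lemma norm_xy_sq (p : Amb3) : ‖xy p‖ ^ 2 = xy p 0 ^ 2 + xy p 1 ^ 2 := by
  simp [EuclideanSpace.norm_sq_eq, Fin.sum_univ_two, sq_abs]

lemma isClosed_Xset : IsClosed Xset := by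
  have h0 := continuous_xy_apply 0
  have h1 := continuous_xy_apply 1
  have hz := continuous_zc
  exact ((isClosed_le ((h1.pow 2).add (hz.pow 2)) (h0.pow 2)).union
    (isClosed_le ((h0.pow 2).add (hz.pow 2)) (h1.pow 2))).inter
    (isClosed_le hz.abs ((h0.pow 2).add (h1.pow 2)))

/-- Exchanging `x` and `y` preserves `Xset`. -/
lemma swap_mem_Xset {p : Amb3} (hp : p ∈ Xset) : mkPt (xy p 1) (xy p 0) (zc p) ∈ Xset := by
  obtain ⟨h | h, h'⟩ := hp
  · refine ⟨Or.inr ?_, ?_⟩ <;> simp only [Set.mem_ofPred_eq, xy_mkPt_zero, xy_mkPt_one, zc_mkPt] at *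
    · linarith
    · linarith
  · refine ⟨Or.inl ?_, ?_⟩ <;> simp only [Set.mem_ofPred_eq, xy_mkPt_zero, xy_mkPt_one, zc_mkPt] at *
    · linarith
    · linarith

/-- On the plane `x = y` the set `Xset` is horizontal. -/
lemma zc_eq_zero_of_mem_Xset {p : Amb3} (hp : p ∈ Xset) (h : xy p 0 = xy p 1) : zc p = 0 := by
  rcases hp.1 with h' | h' <;> simp only [Set.mem_ofPred_eq] at h' <;> rw [h] at h' <;> nlinarith

lemma tendsto_mkPt_zero {f g h : ℝ → ℝ} (hf : Continuous f) (hg : Continuous g)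
    (hh : Continuous h) (f0 : f 0 = 0) (g0 : g 0 = 0) (h0 : h 0 = 0) :
    Tendsto (fun t => mkPt (f t) (g t) (h t)) (𝓝[>] 0) (𝓝 0) := by
  rw [tendsto_iff_dist_tendsto_zero]
  have hc : Continuous fun t => √(f t ^ 2 + g t ^ 2 + h t ^ 2) := by fun_prop
  have := (hc.tendsto 0).mono_left (nhdsWithin_le_nhds (s := Set.Ioi 0))
  simpa [-dist_zero_right, amb3_dist_eq, f0, g0, h0, xy, zc, mkPt] using this

lemma mkPt_mem_medialAxis {t : ℝ} (ht : 0 < t) (ht1 : t < 1) :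
    mkPt t t (t ^ 2) ∈ medialAxis Xset := by
  have ht3 : 0 < t ^ 3 := by positivity
  have htt : t ^ 3 < t := by nlinarith [mul_pos ht ht]
  have hq : mkPt (t + t ^ 3 / 4) (t - t ^ 3 / 4) (t ^ 2) ∈ Xset := by
    refine ⟨Or.inl ?_, ?_⟩ <;> simp only [Set.mem_ofPred_eq, xy_mkPt_zero, xy_mkPt_one, zc_mkPt]
    · nlinarith
    · rw [abs_of_pos (by positivity)]
      nlinarith [sq_nonneg (t ^ 3)]
  obtain ⟨p, hp, hpd⟩ := isClosed_Xset.exists_infDist_eq_dist ⟨_, hq⟩ (mkPt t t (t ^ 2))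
  refine ⟨p, ⟨hp, hpd.symm⟩, mkPt (xy p 1) (xy p 0) (zc p), ⟨swap_mem_Xset hp, ?_⟩, fun he => ?_⟩
  · rw [hpd, amb3_dist_eq, amb3_dist_eq]
    simp only [xy_mkPt_zero, xy_mkPt_one, zc_mkPt]
    congr 1
    ring
  · have hxy : xy p 0 = xy p 1 := congrArg (fun r => xy r 0) he
    have hz := zc_eq_zero_of_mem_Xset hp hxy
    have hle := hpd ▸ infDist_le_dist_of_mem (x := mkPt t t (t ^ 2)) hq
    rw [amb3_dist_eq, amb3_dist_eq, Real.sqrt_le_sqrt_iff (by positivity)] at hle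
    simp only [xy_mkPt_zero, xy_mkPt_one, zc_mkPt, hz] at hle
    have : t ^ 3 * t ^ 3 < t * t * (t * t) := by
      have : t ^ 3 < t * t := by nlinarith [mul_pos ht ht]
      nlinarith
    nlinarith [sq_nonneg (t - xy p 0), sq_nonneg (t - xy p 1)]

lemma zero_mem_closure_medialAxis : (0 : Amb3) ∈ closure (medialAxis Xset) :=
  mem_closure_of_tendsto
    (tendsto_mkPt_zero continuous_id continuous_id (continuous_pow 2) rfl rfl (by simp))
    (by
      filter_upwards [Ioo_mem_nhdsGT (zero_lt_one' ℝ)] with t ht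
      exact mkPt_mem_medialAxis ht.1 ht.2)

lemma parabola_mem_Xset {s : ℝ} (h0 : 0 < s) (h1 : s < 1) : mkPt s 0 (s ^ 2) ∈ Xset := by
  refine ⟨Or.inl ?_, ?_⟩ <;> simp only [Set.mem_ofPred_eq, xy_mkPt_zero, xy_mkPt_one, zc_mkPt]
  · nlinarith [mul_pos (pow_pos h0 2) (sub_pos.2 (pow_lt_one₀ h0.le h1 two_ne_zero))]
  · rw [abs_of_pos (by positivity)]
    simp

lemma genCurv_Xset : genCurv Xset = 2 := by
  apply le_antisymm
  · apply sSup_le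
    rintro _ ⟨θ, ⟨-, C, hC, U, hU, hsub⟩, rfl⟩
    by_contra! hlt
    have hθ : 2 < θ := by
      by_contra! h
      exact absurd (ENNReal.ofReal_le_ofReal h) (by simpa using hlt)
    have hpt := tendsto_mkPt_zero continuous_id continuous_zero (continuous_pow 2) rfl rfl (by simp)
    have hpow : Tendsto (fun s : ℝ => C * s ^ (θ - 2)) (𝓝[>] 0) (𝓝 0) := by
      have := ((Real.continuous_rpow_const (by linarith : 0 ≤ θ - 2)).const_mul C).tendsto 0
      rw [Real.zero_rpow (by linarith), mul_zero] at this
      exact this.mono_left nhdsWithin_le_nhds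
    obtain ⟨s, ⟨hs0, hs1⟩, hsU, hs⟩ := (Filter.Eventually.and (Ioo_mem_nhdsGT one_pos)
      ((hpt.eventually hU).and (hpow.eventually_lt_const one_pos))).exists
    have hmem := hsub ⟨parabola_mem_Xset hs0 hs1, hsU⟩
    have hn : ‖xy (mkPt s 0 (s ^ 2))‖ = s := by
      rw [← sq_eq_sq₀ (norm_nonneg _) hs0.le, norm_xy_sq]
      simp
    simp only [Set.mem_ofPred_eq, hn, zc_mkPt, Real.norm_eq_abs, abs_sq] at hmem
    have hsplit : s ^ θ = s ^ (θ - 2) * s ^ 2 := by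
      rw [← Real.rpow_natCast s 2, ← Real.rpow_add hs0]
      norm_num
    rw [hsplit] at hmem
    nlinarith [pow_pos hs0 2]
  · refine le_sSup ⟨2, ⟨two_pos, 1, one_pos, Set.univ, univ_mem, ?_⟩, by simp⟩
    rintro p ⟨⟨-, hp⟩, -⟩
    simp only [Set.mem_ofPred_eq, Real.rpow_two, one_mul, norm_xy_sq]
    exact hp

/-- the set `X` is not superquadratic at the origin — its general
curvature is exactly `2` — and yet its medial axis reaches the origin. -/
theorem stmt16 :
    genCurv Xset = 2 ∧ ¬ genCurv Xset < 2 ∧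
    (0 : Amb3) ∈ closure (medialAxis Xset) := by
  exact ⟨genCurv_Xset, genCurv_Xset.not_lt, zero_mem_closure_medialAxis⟩
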